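/- arXiv:2211.13456 — 2 statements merged into one kernel-verified Lean document; each statement's English description precedes it below -/
import Mathlib

section
/- Let W ⊆ V⊗ℝ^ℓ be a geometric non-local space, let α = −κ′(1)/log m, and let φ: W → V be a canceling linear operator. Then there exist constants C₁, C₂, C₃ with 1 ≤ C₁ ≤ C₂ ≤ C₃ such that the function Φ(x,y,z,t,s) = |y|·t + C₁·|x|·t + C₂·|x|·√(s·t) + C₃·(z−|x|)·s is a supersolution, i.e. it satisfies the main inequality and the boundary inequality. -/
open MeasureTheory Finset

noncomputable section

namespace TracePaper

variable {ι : Type} [Fintype ι]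
variable {E : Type} [AddCommGroup E] [Module ℝ E]

/-- A martingale adapted to the `ι`-uniform filtration, recorded by its values on atoms:
`val n c` is the value of `F_n` on the atom determined by the digit string `c`. -/
structure Mart (ι : Type) [Fintype ι] (E : Type) [AddCommGroup E] [Module ℝ E] where
  val : (n : ℕ) → (Fin n → ι) → E
  avg_eq : ∀ (n : ℕ) (c : Fin n → ι),
    val n c = (Fintype.card ι : ℝ)⁻¹ • ∑ j : ι, val (n + 1) (Fin.snoc c j)

/-- The martingale difference `dF_{n+1}|_ω` on the atom `ω = c ∈ 𝒜ℱ_n`, as an element of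
`V ⊗ E` (an `ι`-tuple with zero average). -/
def diff (F : Mart ι E) (n : ℕ) (c : Fin n → ι) : ι → E :=
  fun j => F.val (n + 1) (Fin.snoc c j) - F.val n c

/-- `F ∈ 𝕎`: all martingale differences lie in `W`. -/
def MemSpace (W : Set (ι → E)) (F : Mart ι E) : Prop :=
  ∀ (n : ℕ) (c : Fin n → ι), diff F n c ∈ W

/-- A simple martingale: all but finitely many differences vanish. -/
def Simple (F : Mart ι E) : Prop :=
  ∃ N : ℕ, ∀ n, N ≤ n → ∀ c : Fin n → ι, diff F n c = 0

/-- Average of an `ι`-tuple. -/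
def avg (X : ι → E) : E := (Fintype.card ι : ℝ)⁻¹ • ∑ j, X j

/-- The set `𝕄^W` of admissible `0`-flat increments. -/
def MW (W : Set (ι → E)) : Set (ι → ℝ) :=
  {v | (∑ j, v j = 0) ∧ (∀ j, -1 ≤ v j) ∧ ∃ a : E, a ≠ 0 ∧ (fun j => v j • a) ∈ W}

/-- `κ_v(θ) = θ log((1/m) ∑_j |1+v_j|^{1/θ})`, extended by continuity at `θ = 0`. -/
def kappaV (ι : Type) [Fintype ι] (v : ι → ℝ) (θ : ℝ) : ℝ :=
  if θ = 0 then Real.log (⨆ j, |1 + v j|)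
  else θ * Real.log ((Fintype.card ι : ℝ)⁻¹ * ∑ j, |1 + v j| ^ (1 / θ))

/-- `κ(θ) = sup {κ_v(θ) : v ∈ 𝕄^W}`. -/
def kappa (W : Set (ι → E)) (θ : ℝ) : ℝ :=
  sSup {r | ∃ v ∈ MW W, r = kappaV ι v θ}

/-- `κ'(1) = inf { -(1/m) ∑_j (1+v_j) log(1+v_j) : v ∈ 𝕄^W }`. -/
def kprime1 (W : Set (ι → E)) : ℝ :=
  sInf {r | ∃ v ∈ MW W,
    r = -((Fintype.card ι : ℝ)⁻¹ * ∑ j, (1 + v j) * Real.log (1 + v j))}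

/-- `W` is geometric (κ affine) with `α = -κ'(1)/log m`; equivalently
`κ(θ) = α (log m)(1-θ)` on `[0,1]`. -/
def GeometricOfOrder (W : Set (ι → E)) (α : ℝ) : Prop :=
  ∀ θ ∈ Set.Icc (0 : ℝ) 1, kappa W θ = α * Real.log (Fintype.card ι) * (1 - θ)

/-- `w = v ⊗ a` is an extremal vector with support `H`. -/
def IsExtremal (W : Set (ι → E)) (α : ℝ) (w : ι → E) (H : Finset ι) : Prop :=
  w ∈ W ∧ ∃ a : E, a ≠ 0 ∧ (H.card : ℝ) = (Fintype.card ι : ℝ) ^ ((1 : ℝ) - α) ∧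
    (∀ j ∈ H, w j = ((Fintype.card ι : ℝ) ^ α - 1) • a) ∧ ∀ j ∉ H, w j = -a

/-- `φ` is a canceling operator. -/
def Canceling (W : Set (ι → E)) (α : ℝ) (φ : (ι → E) → ι → ℝ) : Prop :=
  ∀ (w : ι → E) (H : Finset ι), IsExtremal W α w H → ∀ j ∈ H, φ w j = 0

/-- `W` is a non-local space (of order `α`). -/
def NonLocal (W : Set (ι → E)) (α : ℝ) : Prop :=
  ∀ (w : ι → E) (H : Finset ι), IsExtremal W α w H →
    ∀ u ∈ W, ∀ b : E, (∀ j ∉ H, b + u j = 0) → ∃ c : ℝ, u = c • w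

/-- The martingale transform `𝕀_α[F]`, as a function of the path `γ ∈ 𝕋`. -/
def Ialpha (φ : (ι → E) → ι → ℝ) (α : ℝ) (F : Mart ι E) (γ : ℕ → ι) : ℝ :=
  ∑' n : ℕ, (Fintype.card ι : ℝ) ^ (-(α * n)) *
    φ (diff F n (fun i : Fin n => γ i)) (γ n)

/-- The cylinder (atom of `ℱ_n`) determined by the digit string `c`. -/
def cyl (n : ℕ) (c : Fin n → ι) : Set (ℕ → ι) := {γ | ∀ i : Fin n, γ i = c i}

/-- The Borel σ-algebra of `𝕋` (= the product σ-algebra). -/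
def treeMS (ι : Type) : MeasurableSpace (ℕ → ι) :=
  @MeasurableSpace.pi ℕ (fun _ => ι) (fun _ => ⊤)

section Normed
variable {E' : Type} [NormedAddCommGroup E'] [NormedSpace ℝ E']

/-- `‖F‖_{L¹} = sup_n 𝔼 |F_n|`. -/
def L1Norm (F : Mart ι E') : ℝ :=
  ⨆ n : ℕ, ((Fintype.card ι : ℝ) ^ n)⁻¹ * ∑ c : Fin n → ι, ‖F.val n c‖

/-- The bilinear trace inequality
`∫_𝕋 |𝕀_α[F]| dν ≲ (sup_{n,ω} m^{(1-α)n} ν(ω)) ‖F‖_{L¹}`. -/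
def TraceIneq (W : Set (ι → E')) (φ : (ι → E') → ι → ℝ) (α : ℝ) : Prop :=
  ∃ C : ℝ, ∀ ν : @Measure (ℕ → ι) (treeMS ι), IsFiniteMeasure ν →
    ∀ F : Mart ι E', MemSpace W F → Simple F →
      ∀ A : ℝ,
        (∀ (n : ℕ) (c : Fin n → ι),
          (Fintype.card ι : ℝ) ^ (((1 : ℝ) - α) * n) * (ν (cyl n c)).toReal ≤ A) →
        ∫ γ, |Ialpha φ α F γ| ∂ν ≤ C * A * L1Norm F

/-- The Bellman main inequality for `G` on the Bellman domain. -/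
def MainInequality (W : Set (ι → E')) (φ : (ι → E') → ι → ℝ) (α : ℝ)
    (G : E' → ℝ → ℝ → ℝ → ℝ → ℝ) : Prop :=
  ∀ (X : ι → E') (y : ℝ) (Z T S : ι → ℝ),
    (∀ j, ‖X j‖ ≤ Z j) → (∀ j, 0 ≤ T j) → (∀ j, T j ≤ S j) →
    (fun j => X j - avg X) ∈ W →
    (Fintype.card ι : ℝ) ^ (-α) *
        ∑ j, G (X j) ((Fintype.card ι : ℝ) ^ α * y + φ (fun i => X i - avg X) j)
          (Z j) (T j) (S j)
      ≤ G (avg X) y ((Fintype.card ι : ℝ)⁻¹ * ∑ j, Z j) (∑ j, T j)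
          (max (∑ j, T j) ((Fintype.card ι : ℝ) ^ ((1 : ℝ) - α) * ⨆ j, S j))

/-- The boundary inequality `G(x, y, |x|, t, s) ≥ |y| t`. -/
def BoundaryIneq (G : E' → ℝ → ℝ → ℝ → ℝ → ℝ) : Prop :=
  ∀ (x : E') (y t s : ℝ), 0 ≤ t → t ≤ s → |y| * t ≤ G x y ‖x‖ t s

/-- A supersolution: main inequality + boundary inequality. -/
def Supersolution (W : Set (ι → E')) (φ : (ι → E') → ι → ℝ) (α : ℝ)
    (G : E' → ℝ → ℝ → ℝ → ℝ → ℝ) : Prop :=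
  MainInequality W φ α G ∧ BoundaryIneq G

end Normed

section Helpers

open Filter Topology

variable {F : Type} [NormedAddCommGroup F] [InnerProductSpace ℝ F] [FiniteDimensional ℝ F]
variable {m : ℕ} {W : Submodule ℝ (Fin m → F)}

/-- The values `x_j = x + w_j`. -/
def xs (p : F × W) (j : Fin m) : F := p.1 + (p.2 : Fin m → F) j

/-- The defect `avg |x_j| - |x|`. -/
def DD (p : F × W) : ℝ := (m : ℝ)⁻¹ * ∑ j, ‖xs p j‖ - ‖p.1‖

/-- Normalized second moment. -/
def AA (M : ℝ) (p : F × W) : ℝ := Real.sqrt ((∑ j, ‖xs p j‖ ^ 2) / (M * m))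

/-- Reduced inequality. -/
def RR (M : ℝ) (φ : (Fin m → F) →ₗ[ℝ] (Fin m → ℝ)) (C₁ C₂ C₃ : ℝ) (p : F × W) : Prop :=
  ∀ u : Fin m → ℝ, (∀ j, 0 ≤ u j) → ∑ j, u j ≤ 1 →
    M⁻¹ * ∑ j, |φ (p.2 : Fin m → F) j| * u j
      + C₁ * (M⁻¹ * ∑ j, ‖xs p j‖ * u j - ‖p.1‖ * ∑ j, u j)
      + C₂ * (Real.sqrt (∑ j, u j) * (AA M p - ‖p.1‖)) ≤ C₃ * DD p

lemma exists_bound_of_ker_le {P G H : Type} [AddCommGroup P] [Module ℝ P]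
    [NormedAddCommGroup G] [NormedSpace ℝ G]
    [NormedAddCommGroup H] [NormedSpace ℝ H] [FiniteDimensional ℝ H]
    (f : P →ₗ[ℝ] G) (L : P →ₗ[ℝ] H) (h : LinearMap.ker L ≤ LinearMap.ker f) :
    ∃ K : ℝ, 0 ≤ K ∧ ∀ p, ‖f p‖ ≤ K * ‖L p‖ := by
  obtain ⟨g, hg⟩ : ∃ g : H →ₗ[ℝ] G, f = g ∘ₗ L := by
    obtain ⟨s, hs⟩ := (L.rangeRestrict).exists_rightInverse_of_surjective
      (LinearMap.range_rangeRestrict L)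
    obtain ⟨g, hg⟩ := LinearMap.exists_extend (p := LinearMap.range L) (f ∘ₗ s)
    refine ⟨g, ?_⟩
    ext p
    have h1 : g (L p) = f (s (L.rangeRestrict p)) := by
      have := congrArg (fun k => k (L.rangeRestrict p)) hg
      simpa using this
    have h2 : s (L.rangeRestrict p) - p ∈ LinearMap.ker L := by
      have := congrArg (fun k => ((k (L.rangeRestrict p) : LinearMap.range L) : H)) hs
      simp at this
      simp [this]
    have h3 := h h2
    simp only [LinearMap.mem_ker, map_sub, sub_eq_zero] at h3
    simp [h1, h3]
  refine ⟨‖LinearMap.toContinuousLinearMap g‖, norm_nonneg _, fun p => ?_⟩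
  rw [hg]
  exact (LinearMap.toContinuousLinearMap g).le_opNorm (L p)

lemma continuous_xs (j : Fin m) : Continuous (fun p : F × W => xs p j) := by
  unfold xs
  exact continuous_fst.add ((continuous_apply j).comp
    (continuous_subtype_val.comp continuous_snd))

lemma continuous_DD : Continuous (DD : F × W → ℝ) := by
  unfold DD
  have := fun j => continuous_xs (F := F) (W := W) j
  fun_prop

lemma continuous_AA (M : ℝ) : Continuous (AA M : F × W → ℝ) := by
  unfold AA
  have := fun j => continuous_xs (F := F) (W := W) j
  fun_prop

lemma continuous_phi (φ : (Fin m → F) →ₗ[ℝ] (Fin m → ℝ)) :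
    Continuous (fun p : F × W => ∑ j, |φ (p.2 : Fin m → F) j|) := by
  have : Continuous φ := φ.continuous_of_finiteDimensional
  fun_prop

lemma sum_xs (hWV : ∀ w ∈ W, ∑ j, w j = 0) (p : F × W) : ∑ j, xs p j = (m : ℝ) • p.1 := by
  simp [xs, sum_add_distrib, hWV _ p.2.2, Nat.cast_smul_eq_nsmul]

lemma DD_nonneg (hm : 2 ≤ m) (hWV : ∀ w ∈ W, ∑ j, w j = 0) (p : F × W) : 0 ≤ DD p := by
  have hm0 : (0 : ℝ) < m := by positivity
  have h := norm_sum_le (Finset.univ) (fun j => xs p j)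
  rw [sum_xs hWV p, norm_smul, Real.norm_of_nonneg hm0.le] at h
  unfold DD
  have : ‖p.1‖ = (m : ℝ)⁻¹ * (m * ‖p.1‖) := by field_simp
  rw [this, ← mul_sub]
  exact mul_nonneg (by positivity) (by linarith)

lemma sqrt_facts {t : ℝ} (h0 : 0 ≤ t) (h1 : t ≤ 1) :
    0 ≤ Real.sqrt t ∧ Real.sqrt t ≤ 1 ∧ t ≤ Real.sqrt t := by
  refine ⟨Real.sqrt_nonneg _, Real.sqrt_le_one.mpr h1, Real.le_sqrt_of_sq_le ?_⟩
  nlinarith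

lemma sum_mul_le {f u : Fin m → ℝ} (hf : ∀ j, 0 ≤ f j) (hu : ∀ j, 0 ≤ u j) :
    ∑ j, f j * u j ≤ (∑ j, f j) * ∑ j, u j := by
  rw [mul_sum]
  exact sum_le_sum fun j _ => mul_le_mul_of_nonneg_right
    (single_le_sum (f := f) (fun i _ => hf i) (mem_univ j)) (hu j)

/-- Case A: positive defect. -/
lemma caseA {M : ℝ} (hM : 1 ≤ M) (φ : (Fin m → F) →ₗ[ℝ] (Fin m → ℝ))
    (p₀ : F × W) (hD : 0 < DD p₀) :
    ∃ U ∈ 𝓝 p₀, ∀ᶠ C₁ in atTop, ∀ᶠ C₂ in atTop, ∀ᶠ C₃ in atTop, ∀ p ∈ U, RR M φ C₁ C₂ C₃ p := by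
  have hxc : Continuous (fun p : F × W => ∑ j, ‖xs p j‖) := by
    have := fun j => continuous_xs (F := F) (W := W) j
    fun_prop
  have e1 := (continuous_phi (W := W) φ).continuousAt.eventually (eventually_lt_nhds
    (lt_add_one (∑ j, |φ (p₀.2 : Fin m → F) j|)))
  have e2 := (hxc.continuousAt (x := p₀)).eventually (eventually_lt_nhds
    (lt_add_one (∑ j, ‖xs p₀ j‖)))
  have e3 := ((continuous_AA (W := W) M).continuousAt (x := p₀)).eventually (eventually_lt_nhds
    (lt_add_one (AA M p₀)))
  have e4 := ((continuous_DD (W := W)).continuousAt (x := p₀)).eventually (eventually_gt_nhds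
    (half_lt_self hD))
  set B1 := ∑ j, |φ (p₀.2 : Fin m → F) j| + 1
  set B2 := ∑ j, ‖xs p₀ j‖ + 1
  set B3 := AA M p₀ + 1
  refine ⟨_, (e1.and (e2.and (e3.and e4))), ?_⟩
  filter_upwards [eventually_ge_atTop 0] with C₁ h1
  filter_upwards [eventually_ge_atTop 0] with C₂ h2
  filter_upwards [eventually_ge_atTop ((B1 + C₁ * B2 + C₂ * B3) / (DD p₀ / 2)),
    eventually_ge_atTop 0] with C₃ h3 h30
  rintro p ⟨g1, g2, g3, g4⟩ u hu hu1
  have ht0 : 0 ≤ ∑ j, u j := sum_nonneg fun j _ => hu j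
  obtain ⟨q0, q1, q2⟩ := sqrt_facts ht0 hu1
  have hMi : M⁻¹ ≤ 1 := inv_le_one_of_one_le₀ hM
  have hMi0 : 0 ≤ M⁻¹ := by positivity
  have k1 := sum_mul_le (f := fun j => |φ (p.2 : Fin m → F) j|) (fun j => abs_nonneg _) hu
  have k2 := sum_mul_le (f := fun j => ‖xs p j‖) (fun j => norm_nonneg _) hu
  have n1 : 0 ≤ ∑ j, |φ (p.2 : Fin m → F) j| := sum_nonneg fun j _ => abs_nonneg _
  have n2 : 0 ≤ ∑ j, ‖xs p j‖ := sum_nonneg fun j _ => norm_nonneg _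
  have n1' : 0 ≤ ∑ j, |φ (p.2 : Fin m → F) j| * u j :=
    sum_nonneg fun j _ => mul_nonneg (abs_nonneg _) (hu j)
  have n2' : 0 ≤ ∑ j, ‖xs p j‖ * u j := sum_nonneg fun j _ => mul_nonneg (norm_nonneg _) (hu j)
  have n3 : 0 ≤ AA M p := Real.sqrt_nonneg _
  have a1 : M⁻¹ * ∑ j, |φ (p.2 : Fin m → F) j| * u j ≤ B1 := by
    nlinarith [mul_le_mul_of_nonneg_left hu1 n1]
  have a2 : M⁻¹ * ∑ j, ‖xs p j‖ * u j - ‖p.1‖ * ∑ j, u j ≤ B2 := by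
    nlinarith [mul_le_mul_of_nonneg_left hu1 n2, mul_nonneg (norm_nonneg p.1) ht0]
  have a3 : Real.sqrt (∑ j, u j) * (AA M p - ‖p.1‖) ≤ B3 := by
    nlinarith [mul_nonneg q0 (norm_nonneg p.1), mul_le_mul_of_nonneg_right q1 n3]
  have a4 := mul_le_mul_of_nonneg_left a2 h1
  have a5 := mul_le_mul_of_nonneg_left a3 h2
  rw [div_le_iff₀ (by positivity)] at h3
  have a6 := mul_le_mul_of_nonneg_left g4.le h30
  linarith

/-- Case B1: strict second moment inequality. -/
lemma caseB1 {M : ℝ} (hM : 1 ≤ M) (hm : 2 ≤ m) (hWV : ∀ w ∈ W, ∑ j, w j = 0)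
    (φ : (Fin m → F) →ₗ[ℝ] (Fin m → ℝ))
    (p₀ : F × W) (hA : AA M p₀ < ‖p₀.1‖) :
    ∃ U ∈ 𝓝 p₀, ∀ᶠ C₁ in atTop, ∀ᶠ C₂ in atTop, ∀ᶠ C₃ in atTop, ∀ p ∈ U, RR M φ C₁ C₂ C₃ p := by
  have hxc : Continuous (fun p : F × W => ∑ j, ‖xs p j‖) := by
    have := fun j => continuous_xs (F := F) (W := W) j
    fun_prop
  have hac : Continuous (fun p : F × W => AA M p - ‖p.1‖) := by
    have := continuous_AA (F := F) (W := W) M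
    fun_prop
  have e1 := (continuous_phi (W := W) φ).continuousAt.eventually (eventually_lt_nhds
    (lt_add_one (∑ j, |φ (p₀.2 : Fin m → F) j|)))
  have e2 := (hxc.continuousAt (x := p₀)).eventually (eventually_lt_nhds
    (lt_add_one (∑ j, ‖xs p₀ j‖)))
  set c := (‖p₀.1‖ - AA M p₀) / 2 with hc
  have hc0 : 0 < c := by rw [hc]; linarith
  have e3 := (hac.continuousAt (x := p₀)).eventually (eventually_lt_nhds
    (show AA M p₀ - ‖p₀.1‖ < -c by rw [hc]; linarith))
  set B1 := ∑ j, |φ (p₀.2 : Fin m → F) j| + 1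
  set B2 := ∑ j, ‖xs p₀ j‖ + 1
  refine ⟨_, (e1.and (e2.and e3)), ?_⟩
  filter_upwards [eventually_ge_atTop 0] with C₁ h1
  filter_upwards [eventually_ge_atTop ((B1 + C₁ * B2) / c), eventually_ge_atTop 0] with C₂ h2 h20
  filter_upwards [eventually_ge_atTop 0] with C₃ h3
  rintro p ⟨g1, g2, g3⟩ u hu hu1
  have ht0 : 0 ≤ ∑ j, u j := sum_nonneg fun j _ => hu j
  obtain ⟨q0, q1, q2⟩ := sqrt_facts ht0 hu1
  have hMi : M⁻¹ ≤ 1 := inv_le_one_of_one_le₀ hM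
  have hMi0 : 0 ≤ M⁻¹ := by positivity
  have k1 := sum_mul_le (f := fun j => |φ (p.2 : Fin m → F) j|) (fun j => abs_nonneg _) hu
  have k2 := sum_mul_le (f := fun j => ‖xs p j‖) (fun j => norm_nonneg _) hu
  have n1 : 0 ≤ ∑ j, |φ (p.2 : Fin m → F) j| := sum_nonneg fun j _ => abs_nonneg _
  have n2 : 0 ≤ ∑ j, ‖xs p j‖ := sum_nonneg fun j _ => norm_nonneg _
  have n1' : 0 ≤ ∑ j, |φ (p.2 : Fin m → F) j| * u j :=
    sum_nonneg fun j _ => mul_nonneg (abs_nonneg _) (hu j)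
  have n2' : 0 ≤ ∑ j, ‖xs p j‖ * u j := sum_nonneg fun j _ => mul_nonneg (norm_nonneg _) (hu j)
  set r := Real.sqrt (∑ j, u j)
  have a1 : M⁻¹ * ∑ j, |φ (p.2 : Fin m → F) j| * u j ≤ B1 * r := by
    calc _ ≤ 1 * ∑ j, |φ (p.2 : Fin m → F) j| * u j := mul_le_mul_of_nonneg_right hMi n1'
      _ ≤ (∑ j, |φ (p.2 : Fin m → F) j|) * ∑ j, u j := by rw [one_mul]; exact k1
      _ ≤ B1 * r := mul_le_mul g1.le q2 ht0 (n1.trans g1.le)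
  have a2 : M⁻¹ * ∑ j, ‖xs p j‖ * u j - ‖p.1‖ * ∑ j, u j ≤ B2 * r := by
    have : M⁻¹ * ∑ j, ‖xs p j‖ * u j ≤ B2 * r := by
      calc _ ≤ 1 * ∑ j, ‖xs p j‖ * u j := mul_le_mul_of_nonneg_right hMi n2'
        _ ≤ (∑ j, ‖xs p j‖) * ∑ j, u j := by rw [one_mul]; exact k2
        _ ≤ B2 * r := mul_le_mul g2.le q2 ht0 (n2.trans g2.le)
    linarith [mul_nonneg (norm_nonneg p.1) ht0]
  have a3 : r * (AA M p - ‖p.1‖) ≤ r * (-c) := mul_le_mul_of_nonneg_left g3.le q0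
  have a4 := mul_le_mul_of_nonneg_left a2 h1
  have a5 := mul_le_mul_of_nonneg_left a3 h20
  rw [div_le_iff₀ (by positivity)] at h2
  have a6 := mul_le_mul_of_nonneg_right h2 q0
  have a7 := mul_nonneg h3 (DD_nonneg hm hWV p)
  linarith

set_option maxHeartbeats 1000000 in
/-- Case B2: near an extremal vector. -/
lemma caseB2 {M : ℝ} (hM : 1 ≤ M) (hm : 2 ≤ m) (hWV : ∀ w ∈ W, ∑ j, w j = 0)
    (φ : (Fin m → F) →ₗ[ℝ] (Fin m → ℝ))
    (p₀ : F × W) (hx0 : p₀.1 ≠ 0) (H : Finset (Fin m)) (hcard : (H.card : ℝ) * M = m)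
    (hH : ∀ j ∈ H, xs p₀ j = M • p₀.1) (hHc : ∀ j ∉ H, xs p₀ j = 0)
    (hHne : ∃ j, j ∉ H)
    (hnl : ∀ u ∈ W, ∀ b : F, (∀ j ∉ H, b + u j = 0) → ∃ c : ℝ, u = c • (p₀.2 : Fin m → F))
    (hcanc : ∀ j ∈ H, φ (p₀.2 : Fin m → F) j = 0) :
    ∃ U ∈ 𝓝 p₀, ∀ᶠ C₁ in atTop, ∀ᶠ C₂ in atTop, ∀ᶠ C₃ in atTop, ∀ p ∈ U, RR M φ C₁ C₂ C₃ p := by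
  classical
  have hm0 : (0 : ℝ) < m := by positivity
  have hM0 : 0 < M := by linarith
  -- linear maps
  let L : F × W →ₗ[ℝ] (Fin m → F) := LinearMap.pi fun j =>
    if j ∈ H then 0 else
      LinearMap.fst ℝ F W + (LinearMap.proj j ∘ₗ W.subtype) ∘ₗ LinearMap.snd ℝ F W
  have hL : ∀ p : F × W, ∀ j, L p j = if j ∈ H then 0 else xs p j := by
    intro p j
    by_cases hj : j ∈ H <;> simp [L, hj, xs]
  let f1 : F × W →ₗ[ℝ] (Fin m → F) := LinearMap.pi fun j =>
    if j ∈ H then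
      (LinearMap.fst ℝ F W + (LinearMap.proj j ∘ₗ W.subtype) ∘ₗ LinearMap.snd ℝ F W)
        - M • LinearMap.fst ℝ F W else 0
  have hf1 : ∀ p : F × W, ∀ j ∈ H, f1 p j = xs p j - M • p.1 := by
    intro p j hj
    simp [f1, hj, xs]
  let f2 : F × W →ₗ[ℝ] (Fin m → ℝ) := LinearMap.pi fun j =>
    if j ∈ H then LinearMap.proj j ∘ₗ φ ∘ₗ W.subtype ∘ₗ LinearMap.snd ℝ F W else 0
  have hf2 : ∀ p : F × W, ∀ j ∈ H, f2 p j = φ (p.2 : Fin m → F) j := by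
    intro p j hj
    simp [f2, hj]
  have hker : ∀ p ∈ LinearMap.ker L, ∃ c : ℝ, p = c • p₀ := by
    intro p hp
    have hz : ∀ j ∉ H, p.1 + (p.2 : Fin m → F) j = 0 := by
      intro j hj
      have := congrFun (LinearMap.mem_ker.mp hp) j
      rw [hL, if_neg hj] at this
      simpa [xs] using this
    obtain ⟨c, hc⟩ := hnl _ p.2.2 p.1 hz
    refine ⟨c, Prod.ext ?_ (Subtype.ext hc)⟩
    obtain ⟨j, hj⟩ := hHne
    have h1 := hz j hj
    have h2 := hHc j hj
    rw [hc] at h1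
    unfold xs at h2
    have h3 : (p₀.2 : Fin m → F) j = - p₀.1 := by
      rw [eq_neg_iff_add_eq_zero, add_comm]; exact h2
    simp only [Pi.smul_apply, h3, smul_neg] at h1
    simpa [add_neg_eq_zero] using h1
  have hxsmul : ∀ (c : ℝ) (p : F × W) (j : Fin m), xs (c • p) j = c • xs p j := by
    intro c p j
    simp [xs]
  have hk1 : LinearMap.ker L ≤ LinearMap.ker f1 := by
    intro p hp
    obtain ⟨c, rfl⟩ := hker p hp
    rw [LinearMap.mem_ker]
    ext1 j
    by_cases hj : j ∈ H
    · rw [hf1 _ j hj, hxsmul, hH j hj]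
      simp [smul_comm M c]
    · simp [f1, hj]
  have hk2 : LinearMap.ker L ≤ LinearMap.ker f2 := by
    intro p hp
    obtain ⟨c, rfl⟩ := hker p hp
    rw [LinearMap.mem_ker]
    ext1 j
    by_cases hj : j ∈ H
    · rw [hf2 _ j hj]
      simp [hcanc j hj]
    · simp [f2, hj]
  obtain ⟨K1, hK10, hK1⟩ := exists_bound_of_ker_le f1 L hk1
  obtain ⟨K2, hK20, hK2⟩ := exists_bound_of_ker_le f2 L hk2
  set K := K1 + K2 with hKdef
  have hK0 : 0 ≤ K := by positivity
  obtain ⟨δ, hδdef⟩ : ∃ δ : F × W → ℝ, ∀ p, δ p = ∑ j ∈ Hᶜ, ‖xs p j‖ := ⟨_, fun _ => rfl⟩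
  have hδ0 : ∀ p, 0 ≤ δ p := fun p => by
    rw [hδdef]; exact sum_nonneg fun j _ => norm_nonneg _
  have hLδ : ∀ p, ‖L p‖ ≤ δ p := by
    intro p
    refine (pi_norm_le_iff_of_nonneg (hδ0 p)).mpr fun j => ?_
    rw [hL]
    split_ifs with hj
    · simpa using hδ0 p
    · rw [hδdef]
      exact single_le_sum (f := fun j => ‖xs p j‖) (fun i _ => norm_nonneg _)
        (by simpa using hj)
  have hq : ∀ p, ∀ j ∈ H, ‖xs p j - M • p.1‖ ≤ K * δ p := by
    intro p j hj
    rw [← hf1 p j hj]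
    calc _ ≤ ‖f1 p‖ := norm_le_pi_norm _ _
      _ ≤ K1 * ‖L p‖ := hK1 p
      _ ≤ K * δ p := mul_le_mul (by linarith) (hLδ p) (norm_nonneg _) hK0
  have hφ : ∀ p : F × W, ∀ j ∈ H, |φ (p.2 : Fin m → F) j| ≤ K * δ p := by
    intro p j hj
    rw [← hf2 p j hj]
    calc _ ≤ ‖f2 p‖ := norm_le_pi_norm (f2 p) j
      _ ≤ K2 * ‖L p‖ := hK2 p
      _ ≤ K * δ p := mul_le_mul (by linarith) (hLδ p) (norm_nonneg _) hK0
  -- neighbourhoods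
  clear_value L f1 f2
  have hδc : Continuous δ := by
    rw [funext hδdef]
    have := fun j => continuous_xs (F := F) (W := W) j
    fun_prop
  have hδp0 : δ p₀ = 0 := by
    rw [hδdef]
    refine sum_eq_zero fun j hj => ?_
    rw [hHc j (by simpa using hj), norm_zero]
  have hnx : 0 < ‖p₀.1‖ := norm_pos_iff.mpr hx0
  have e1 := (continuous_phi (W := W) φ).continuousAt.eventually (eventually_lt_nhds
    (lt_add_one (∑ j, |φ (p₀.2 : Fin m → F) j|)))
  set B := ∑ j, |φ (p₀.2 : Fin m → F) j| + 1
  set r := ‖p₀.1‖ / 2 with hr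
  have hr0 : 0 < r := by positivity
  have e2 : ∀ᶠ p : F × W in 𝓝 p₀, r < ‖p.1‖ :=
    (continuous_fst.norm.continuousAt (x := p₀)).eventually (eventually_gt_nhds
      (show r < ‖p₀.1‖ by rw [hr]; linarith))
  have e3 : ∀ᶠ p : F × W in 𝓝 p₀, δ p < r / 2 :=
    (hδc.continuousAt (x := p₀)).eventually (eventually_lt_nhds (by rw [hδp0]; positivity))
  have e4 : ∀ᶠ p : F × W in 𝓝 p₀, (m * K ^ 2 + 1) * δ p < M * r :=
    ((show Continuous (fun p : F × W => (m * K ^ 2 + 1) * δ p) from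
      continuous_const.mul hδc).continuousAt (x := p₀)).eventually
      (eventually_lt_nhds (by beta_reduce; rw [hδp0, mul_zero]; positivity))
  refine ⟨_, (e1.and (e2.and (e3.and e4))), ?_⟩
  filter_upwards [eventually_ge_atTop (B / (r / 2)), eventually_ge_atTop 0] with C₁ h1 h10
  filter_upwards [eventually_ge_atTop (2 * m * ((1 + C₁) * K)), eventually_ge_atTop 0]
    with C₂ h2 h20
  filter_upwards [eventually_ge_atTop C₂] with C₃ h3
  rintro p ⟨g1, g2, g3, g4⟩ u hu hu1
  have ht0 : 0 ≤ ∑ j, u j := sum_nonneg fun j _ => hu j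
  obtain ⟨q0, q1, q2⟩ := sqrt_facts ht0 hu1
  have hMi : M⁻¹ ≤ 1 := inv_le_one_of_one_le₀ hM
  have hMi0 : 0 ≤ M⁻¹ := by positivity
  have hD := DD_nonneg hm hWV p
  have hd := hδ0 p
  have hsplit : ∀ f : Fin m → ℝ, ∑ j, f j = ∑ j ∈ H, f j + ∑ j ∈ Hᶜ, f j :=
    fun f => (sum_add_sum_compl H f).symm
  have hoff : ∀ j ∈ Hᶜ, ‖xs p j‖ ≤ δ p := fun j hj => by
    rw [hδdef]
    exact single_le_sum (f := fun j => ‖xs p j‖) (fun i _ => norm_nonneg _) hj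
  set t := ∑ j, u j with ht
  set τ := ∑ j ∈ Hᶜ, u j with hτ
  have hτ0 : 0 ≤ τ := sum_nonneg fun j _ => hu j
  have hHt : ∑ j ∈ H, u j = t - τ := by rw [ht, hsplit u]; ring
  have hKd : 0 ≤ K * δ p := mul_nonneg hK0 hd
  -- φ term
  have a1 : M⁻¹ * ∑ j, |φ (p.2 : Fin m → F) j| * u j ≤ K * δ p * t + B * τ := by
    have n1' : 0 ≤ ∑ j, |φ (p.2 : Fin m → F) j| * u j :=
      sum_nonneg fun j _ => mul_nonneg (abs_nonneg _) (hu j)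
    have : ∑ j, |φ (p.2 : Fin m → F) j| * u j ≤ K * δ p * (t - τ) + B * τ := by
      rw [hsplit, ← hHt, hτ, mul_sum, mul_sum]
      refine add_le_add (sum_le_sum fun j hj => ?_) (sum_le_sum fun j hj => ?_)
      · exact mul_le_mul_of_nonneg_right (hφ p j hj) (hu j)
      · refine mul_le_mul_of_nonneg_right (le_trans ?_ g1.le) (hu j)
        exact single_le_sum (f := fun j => |φ (p.2 : Fin m → F) j|) (fun i _ => abs_nonneg _)
          (mem_univ j)
    have h' := mul_le_mul_of_nonneg_right hMi n1'
    have := mul_nonneg hKd hτ0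
    linarith
  -- C₁ term
  have a2 : M⁻¹ * ∑ j, ‖xs p j‖ * u j - ‖p.1‖ * t ≤ K * δ p * t - (r / 2) * τ := by
    have e : M⁻¹ * ∑ j, ‖xs p j‖ * u j - ‖p.1‖ * t
        = ∑ j, (M⁻¹ * ‖xs p j‖ - ‖p.1‖) * u j := by
      rw [ht, mul_sum, mul_sum, ← sum_sub_distrib]
      exact sum_congr rfl fun j _ => by ring
    have : ∑ j, (M⁻¹ * ‖xs p j‖ - ‖p.1‖) * u j ≤ K * δ p * (t - τ) + (-(r / 2)) * τ := by
      rw [hsplit, ← hHt, hτ, mul_sum, mul_sum]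
      refine add_le_add (sum_le_sum fun j hj => ?_) (sum_le_sum fun j hj => ?_)
      · refine mul_le_mul_of_nonneg_right ?_ (hu j)
        have i1 : ‖xs p j‖ ≤ K * δ p + M * ‖p.1‖ := by
          have := norm_le_norm_sub_add (xs p j) (M • p.1)
          rw [norm_smul, Real.norm_of_nonneg hM0.le] at this
          linarith [hq p j hj]
        have i2 := mul_le_mul_of_nonneg_left i1 hMi0
        have i3 : M⁻¹ * (K * δ p + M * ‖p.1‖) = M⁻¹ * (K * δ p) + ‖p.1‖ := by
          field_simp
        have i4 := mul_le_mul_of_nonneg_right hMi hKd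
        linarith
      · refine mul_le_mul_of_nonneg_right ?_ (hu j)
        have := mul_le_mul_of_nonneg_right hMi (norm_nonneg (xs p j))
        linarith [hoff j hj]
    rw [e]
    have := mul_nonneg hKd hτ0
    linarith
  -- C₂ term
  have a3 : AA M p - ‖p.1‖ ≤ DD p - δ p / (2 * m) := by
    set x := p.1 with hx
    have hxpos : 0 < ‖x‖ := hr0.trans g2
    have hsx : ∑ j, inner ℝ x (xs p j) = m * ‖x‖ ^ 2 := by
      rw [← inner_sum, sum_xs hWV p, inner_smul_right, real_inner_self_eq_norm_sq]
    have s1 : ∑ j ∈ Hᶜ, inner ℝ x (xs p j) ≥ ‖x‖ * δ p - m * ‖x‖ * DD p := by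
      have b1 : ∑ j ∈ Hᶜ, (‖x‖ * ‖xs p j‖ - inner ℝ x (xs p j))
          ≤ ∑ j, (‖x‖ * ‖xs p j‖ - inner ℝ x (xs p j)) :=
        sum_le_sum_of_subset_of_nonneg (subset_univ _) fun j _ _ =>
          sub_nonneg.mpr (real_inner_le_norm _ _)
      rw [sum_sub_distrib, sum_sub_distrib, hsx, ← mul_sum, ← mul_sum] at b1
      have b2 : m * ‖x‖ * DD p = ‖x‖ * ∑ j, ‖xs p j‖ - m * ‖x‖ ^ 2 := by
        unfold DD
        rw [← hx]
        field_simp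
      rw [← hδdef] at b1
      linarith
    have s2 : ∑ j ∈ H, ‖xs p j‖ ^ 2 ≤ M * m * ‖x‖ ^ 2
        - 2 * M * (∑ j ∈ Hᶜ, inner ℝ x (xs p j)) + m * K ^ 2 * δ p ^ 2 := by
      have b1 : ∀ j ∈ H, ‖xs p j‖ ^ 2 ≤ 2 * M * inner ℝ x (xs p j)
          + (- M ^ 2 * ‖x‖ ^ 2 + (K * δ p) ^ 2) := by
        intro j hj
        have c1 := norm_sub_sq_real (xs p j) (M • x)
        rw [inner_smul_right, norm_smul, Real.norm_of_nonneg hM0.le, real_inner_comm] at c1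
        have c2 := pow_le_pow_left₀ (norm_nonneg _) (hq p j hj) 2
        nlinarith
      have b2 := sum_le_sum b1
      rw [sum_add_distrib, ← mul_sum, sum_const, nsmul_eq_mul] at b2
      rw [hsplit] at hsx
      have b3 : ∑ j ∈ H, inner ℝ x (xs p j) = m * ‖x‖ ^ 2 - ∑ j ∈ Hᶜ, inner ℝ x (xs p j) := by
        linarith
      rw [b3] at b2
      have b4 : (H.card : ℝ) ≤ m := by
        have := card_le_univ H
        rw [Fintype.card_fin] at this
        exact_mod_cast this
      have b5 := mul_le_mul_of_nonneg_right b4 (sq_nonneg (K * δ p))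
      have b6 : (H.card : ℝ) * (- M ^ 2 * ‖x‖ ^ 2 + (K * δ p) ^ 2)
          = - (m * M * ‖x‖ ^ 2) + H.card * (K * δ p) ^ 2 := by
        rw [← hcard]; ring
      rw [b6] at b2
      nlinarith
    have s3 : ∑ j ∈ Hᶜ, ‖xs p j‖ ^ 2 ≤ δ p ^ 2 := by
      calc _ ≤ ∑ j ∈ Hᶜ, δ p * ‖xs p j‖ := sum_le_sum fun j hj => by
            rw [sq]; exact mul_le_mul_of_nonneg_right (hoff j hj) (norm_nonneg _)
        _ = δ p ^ 2 := by rw [← mul_sum, ← hδdef, sq]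
    have s4 : ∑ j, ‖xs p j‖ ^ 2 ≤ M * m * ‖x‖ ^ 2 - M * ‖x‖ * δ p + 2 * M * m * ‖x‖ * DD p := by
      rw [hsplit]
      have d1 := mul_le_mul_of_nonneg_left s1 (show 0 ≤ 2 * M by positivity)
      have d2 := mul_le_mul_of_nonneg_right
        (g4.le.trans (mul_le_mul_of_nonneg_left g2.le hM0.le)) hd
      nlinarith
    have s5 : (∑ j, ‖xs p j‖ ^ 2) / (M * m)
        ≤ ‖x‖ ^ 2 - ‖x‖ * δ p / m + 2 * ‖x‖ * DD p := by
      rw [div_le_iff₀ (by positivity)]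
      refine s4.trans (le_of_eq ?_)
      field_simp
    have hA2 : AA M p ^ 2 = (∑ j, ‖xs p j‖ ^ 2) / (M * m) := by
      unfold AA
      exact Real.sq_sqrt (by positivity)
    rw [← hA2] at s5
    have s6 : 2 * ‖x‖ * (AA M p - ‖x‖) ≤ 2 * ‖x‖ * (DD p - δ p / (2 * m)) := by
      have : 2 * ‖x‖ * (DD p - δ p / (2 * m)) = 2 * ‖x‖ * DD p - ‖x‖ * δ p / m := by
        field_simp
      rw [this]
      nlinarith [sq_nonneg (AA M p - ‖x‖)]
    exact le_of_mul_le_mul_left s6 (by positivity)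
  set ρ := Real.sqrt t
  rw [div_le_iff₀ (by positivity)] at h1
  have f1' := mul_le_mul_of_nonneg_left a2 h10
  have f2' := mul_le_mul_of_nonneg_left (mul_le_mul_of_nonneg_left a3 q0) h20
  have f3' := mul_le_mul_of_nonneg_right h1 hτ0
  have f4' : (1 + C₁) * K * (δ p * t) ≤ C₂ * (ρ * (δ p / (2 * m))) := by
    have o1 : (1 + C₁) * K ≤ C₂ / (2 * m) := by
      rw [le_div_iff₀ (by positivity)]; linarith
    have o2 : δ p * t ≤ δ p * ρ := mul_le_mul_of_nonneg_left q2 hd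
    calc _ ≤ C₂ / (2 * m) * (δ p * ρ) := mul_le_mul o1 o2 (by positivity) (by positivity)
      _ = _ := by ring
  have f5' : C₂ * (ρ * DD p) ≤ C₃ * DD p := by
    have := mul_le_mul_of_nonneg_right q1 hD
    have o := mul_le_mul_of_nonneg_left this h20
    have o' := mul_le_mul_of_nonneg_right h3 hD
    linarith
  nlinarith


/-- Local statement at every nonzero point. -/
lemma local_case {M : ℝ} (hM : 1 < M) (hm : 2 ≤ m) (hWV : ∀ w ∈ W, ∑ j, w j = 0)
    (φ : (Fin m → F) →ₗ[ℝ] (Fin m → ℝ))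
    (hMb : ∀ v ∈ MW (W : Set (Fin m → F)), ∀ j, 1 + v j ≤ M)
    (hloc : ∀ (w : Fin m → F) (H : Finset (Fin m)) (a : F), w ∈ W → a ≠ 0 →
      (H.card : ℝ) * M = m → (∀ j ∈ H, w j = (M - 1) • a) → (∀ j ∉ H, w j = -a) →
      (∀ u ∈ W, ∀ b : F, (∀ j ∉ H, b + u j = 0) → ∃ c : ℝ, u = c • w) ∧ ∀ j ∈ H, φ w j = 0)
    (p₀ : F × W) (hp : p₀ ≠ 0) :
    ∃ U ∈ 𝓝 p₀, ∀ᶠ C₁ in atTop, ∀ᶠ C₂ in atTop, ∀ᶠ C₃ in atTop, ∀ p ∈ U, RR M φ C₁ C₂ C₃ p := by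
  classical
  have hm0 : (0 : ℝ) < m := by positivity
  have hM0 : 0 < M := by linarith
  rcases (DD_nonneg hm hWV p₀).lt_or_eq with hD | hD
  · exact caseA hM.le φ p₀ hD
  by_cases hA : AA M p₀ < ‖p₀.1‖
  · exact caseB1 hM.le hm hWV φ p₀ hA
  have hsum : ∑ j, ‖xs p₀ j‖ = m * ‖p₀.1‖ := by
    unfold DD at hD
    field_simp at hD
    linarith
  set x := p₀.1 with hx
  have hx0 : x ≠ 0 := by
    intro h0
    apply hp
    rw [h0, norm_zero, mul_zero, sum_eq_zero_iff_of_nonneg (fun j _ => norm_nonneg _)] at hsum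
    refine Prod.ext h0 (Subtype.ext (funext fun j => ?_))
    have := hsum j (mem_univ j)
    rw [norm_eq_zero] at this
    unfold xs at this
    rw [← hx, h0, zero_add] at this
    simpa using this
  have hnx : 0 < ‖x‖ := norm_pos_iff.mpr hx0
  have hsx : ∑ j, inner ℝ x (xs p₀ j) = m * ‖x‖ ^ 2 := by
    rw [← inner_sum, sum_xs hWV p₀, inner_smul_right, real_inner_self_eq_norm_sq]
  have hz : ∑ j, (‖x‖ * ‖xs p₀ j‖ - inner ℝ x (xs p₀ j)) = 0 := by
    rw [sum_sub_distrib, ← mul_sum, hsum, hsx]; ring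
  rw [sum_eq_zero_iff_of_nonneg (fun j _ => sub_nonneg.mpr (real_inner_le_norm _ _))] at hz
  set c : Fin m → ℝ := fun j => ‖xs p₀ j‖ / ‖x‖ with hc
  have hc0 : ∀ j, 0 ≤ c j := fun j => by positivity
  have hxc : ∀ j, xs p₀ j = c j • x := by
    intro j
    have h1 : inner ℝ x (xs p₀ j) = ‖x‖ * ‖xs p₀ j‖ := by linarith [hz j (mem_univ j)]
    rw [inner_eq_norm_mul_iff_real] at h1
    rw [hc]
    simp only [div_eq_inv_mul, mul_smul, h1]
    rw [smul_smul, inv_mul_cancel₀ hnx.ne', one_smul]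
  have hwc : ∀ j, (p₀.2 : Fin m → F) j = (c j - 1) • x := by
    intro j
    have := hxc j
    unfold xs at this
    rw [sub_smul, one_smul, ← this, ← hx]
    abel
  have hcsum : ∑ j, c j = m := by
    rw [hc, ← sum_div, hsum]; field_simp
  have hcM : ∀ j, c j ≤ M := by
    intro j
    have := hMb (fun j => c j - 1) ⟨by simp [sum_sub_distrib, hcsum],
      fun j => by linarith [hc0 j], x, hx0, by
        have : (fun j => (c j - 1) • x) = (p₀.2 : Fin m → F) := funext fun j => (hwc j).symm
        rw [this]; exact p₀.2.2⟩ j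
    linarith
  have hsq : M * m ≤ ∑ j, c j ^ 2 := by
    rw [not_lt] at hA
    unfold AA at hA
    rw [Real.le_sqrt (norm_nonneg _) (by positivity), le_div_iff₀ (by positivity)] at hA
    simp only [hc, div_pow]
    rw [← sum_div, le_div_iff₀ (by positivity)]
    linarith
  have hz2 : ∑ j, c j * (M - c j) = 0 := by
    apply le_antisymm
    · have : ∑ j, c j * (M - c j) = M * ∑ j, c j - ∑ j, c j ^ 2 := by
        rw [mul_sum, ← sum_sub_distrib]
        exact sum_congr rfl fun j _ => by ring
      rw [this, hcsum]; linarith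
    · exact sum_nonneg fun j _ => mul_nonneg (hc0 j) (sub_nonneg.mpr (hcM j))
  rw [sum_eq_zero_iff_of_nonneg
    (fun j _ => mul_nonneg (hc0 j) (sub_nonneg.mpr (hcM j)))] at hz2
  set H : Finset (Fin m) := univ.filter fun j => c j ≠ 0 with hHdef
  have hcH : ∀ j ∈ H, c j = M := by
    intro j hj
    have h1 : c j ≠ 0 := by simpa [hHdef] using hj
    have := (mul_eq_zero.mp (hz2 j (mem_univ j))).resolve_left h1
    linarith
  have hcHc : ∀ j ∉ H, c j = 0 := by
    intro j hj
    simpa [hHdef] using hj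
  have hcard : (H.card : ℝ) * M = m := by
    rw [← hcsum, ← sum_subset (subset_univ H) (fun j _ hj => hcHc j hj), sum_congr rfl hcH,
      sum_const, nsmul_eq_mul]
  have hne : ∃ j, j ∉ H := by
    by_contra hcon
    push Not at hcon
    have : H = univ := eq_univ_iff_forall.mpr hcon
    rw [this, card_univ, Fintype.card_fin] at hcard
    nlinarith
  obtain ⟨hn, hcc⟩ := hloc p₀.2 H x p₀.2.2 hx0 hcard
    (fun j hj => by rw [hwc, hcH j hj]) (fun j hj => by rw [hwc, hcHc j hj]; simp)
  exact caseB2 hM.le hm hWV φ p₀ hx0 H hcard (fun j hj => by rw [hxc, hcH j hj])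
    (fun j hj => by rw [hxc, hcHc j hj, zero_smul]) hne hn hcc

lemma xs_smul (c : ℝ) (p : F × W) (j : Fin m) : xs (c • p) j = c • xs p j := by
  simp [xs]

lemma DD_smul {c : ℝ} (hc : 0 ≤ c) (p : F × W) : DD (c • p) = c * DD p := by
  simp only [DD, xs_smul, norm_smul, Real.norm_of_nonneg hc, Prod.smul_fst, ← mul_sum]
  ring

lemma AA_smul {c : ℝ} (hc : 0 ≤ c) (M : ℝ) (p : F × W) : AA M (c • p) = c * AA M p := by
  simp only [AA, xs_smul, norm_smul, Real.norm_of_nonneg hc, mul_pow, ← mul_sum]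
  rw [mul_div_assoc, Real.sqrt_mul (sq_nonneg c), Real.sqrt_sq hc]

lemma RR_smul {c : ℝ} (hc : 0 ≤ c) {M : ℝ} {φ : (Fin m → F) →ₗ[ℝ] (Fin m → ℝ)}
    {C₁ C₂ C₃ : ℝ} {p : F × W} (h : RR M φ C₁ C₂ C₃ p) : RR M φ C₁ C₂ C₃ (c • p) := by
  intro u hu hu1
  have h1 := mul_le_mul_of_nonneg_left (h u hu hu1) hc
  have e1 : ∑ j, |φ ((c • p).2 : Fin m → F) j| * u j
      = c * ∑ j, |φ (p.2 : Fin m → F) j| * u j := by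
    rw [mul_sum]
    refine sum_congr rfl fun j _ => ?_
    simp only [Prod.smul_snd, Submodule.coe_smul, map_smul, Pi.smul_apply, smul_eq_mul, abs_mul,
      abs_of_nonneg hc]
    ring
  have e2 : ∑ j, ‖xs (c • p) j‖ * u j = c * ∑ j, ‖xs p j‖ * u j := by
    rw [mul_sum]
    refine sum_congr rfl fun j _ => ?_
    rw [xs_smul, norm_smul, Real.norm_of_nonneg hc, mul_assoc]
  rw [e1, e2, AA_smul hc, DD_smul hc, Prod.smul_fst, norm_smul, Real.norm_of_nonneg hc]
  refine le_trans (le_of_eq ?_) (h1.trans (le_of_eq ?_)) <;> ring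

lemma exists_constants {M : ℝ} (φ : (Fin m → F) →ₗ[ℝ] (Fin m → ℝ))
    (hl : ∀ p₀ : F × W, p₀ ≠ 0 → ∃ U ∈ 𝓝 p₀, ∀ᶠ C₁ in atTop, ∀ᶠ C₂ in atTop, ∀ᶠ C₃ in atTop,
      ∀ p ∈ U, RR M φ C₁ C₂ C₃ p) :
    ∃ C₁ C₂ C₃ : ℝ, 1 ≤ C₁ ∧ C₁ ≤ C₂ ∧ C₂ ≤ C₃ ∧ ∀ p : F × W, p ≠ 0 → RR M φ C₁ C₂ C₃ p := by
  have hK : IsCompact (Metric.sphere (0 : F × W) 1) := isCompact_sphere _ _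
  have key : ∀ᶠ C₁ in atTop, ∀ᶠ C₂ in atTop, ∀ᶠ C₃ in atTop,
      ∀ p ∈ Metric.sphere (0 : F × W) 1, RR M φ C₁ C₂ C₃ p := by
    refine hK.induction_on (p := fun U => ∀ᶠ C₁ in atTop, ∀ᶠ C₂ in atTop, ∀ᶠ C₃ in atTop,
      ∀ p ∈ U, RR M φ C₁ C₂ C₃ p) ?_ ?_ ?_ ?_
    · simp
    · intro s t hst h
      filter_upwards [h] with C₁ h
      filter_upwards [h] with C₂ h
      filter_upwards [h] with C₃ h
      exact fun p hp => h p (hst hp)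
    · intro s t hs ht
      filter_upwards [hs, ht] with C₁ hs ht
      filter_upwards [hs, ht] with C₂ hs ht
      filter_upwards [hs, ht] with C₃ hs ht
      rintro p (hp | hp)
      · exact hs p hp
      · exact ht p hp
    · intro p hp
      obtain ⟨U, hU, h⟩ := hl p (by
        rintro rfl
        simp at hp)
      exact ⟨U, mem_nhdsWithin_of_mem_nhds hU, h⟩
  obtain ⟨C₁, h, h1⟩ := (key.and (eventually_ge_atTop 1)).exists
  obtain ⟨C₂, h, h2⟩ := (h.and (eventually_ge_atTop C₁)).exists
  obtain ⟨C₃, h, h3⟩ := (h.and (eventually_ge_atTop C₂)).exists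
  refine ⟨C₁, C₂, C₃, h1, h2, h3, fun p hp => ?_⟩
  have hn : ‖p‖ ≠ 0 := norm_ne_zero_iff.mpr hp
  have h4 := h (‖p‖⁻¹ • p) (by simp [norm_smul, hn])
  have h5 := RR_smul (norm_nonneg p) h4
  rwa [smul_smul, mul_inv_cancel₀ hn, one_smul] at h5

lemma RR_zero {M : ℝ} {φ : (Fin m → F) →ₗ[ℝ] (Fin m → ℝ)}
    {C₁ C₂ C₃ : ℝ} : RR M φ C₁ C₂ C₃ (0 : F × W) := by
  intro u _ _
  simp [xs, AA, DD]

/-- From the reduced inequality to the main inequality. -/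
lemma main_of_RR {M N : ℝ} (hM : 1 < M) (hN : 0 < N) (hMN : M * N = m)
    (hm : 2 ≤ m) (φ : (Fin m → F) →ₗ[ℝ] (Fin m → ℝ))
    {C₁ C₂ C₃ : ℝ} (hC₁ : 0 ≤ C₁) (hC₂ : 0 ≤ C₂) (hC₃ : 0 ≤ C₃)
    (hR : ∀ p : F × W, RR M φ C₁ C₂ C₃ p)
    (X : Fin m → F) (x : F) (hxX : (fun j => X j - x) ∈ W) (y : ℝ) (Z T S : Fin m → ℝ) (s : ℝ)
    (hZ : ∀ j, ‖X j‖ ≤ Z j) (hT : ∀ j, 0 ≤ T j) (hTS : ∀ j, T j ≤ S j)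
    (hts : ∑ j, T j ≤ s) (hSs : ∀ j, N * S j ≤ s) :
    M⁻¹ * ∑ j, (|M * y + φ (fun i => X i - x) j| * T j + C₁ * ‖X j‖ * T j
        + C₂ * ‖X j‖ * Real.sqrt (S j * T j) + C₃ * (Z j - ‖X j‖) * S j)
      ≤ |y| * (∑ j, T j) + C₁ * ‖x‖ * (∑ j, T j) + C₂ * ‖x‖ * Real.sqrt (s * ∑ j, T j)
        + C₃ * ((m : ℝ)⁻¹ * ∑ j, Z j - ‖x‖) * s := by
  have hm0 : (0 : ℝ) < m := by positivity
  have hM0 : 0 < M := by linarith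
  have hMi : 0 < M⁻¹ := by positivity
  have hT0 : 0 ≤ ∑ j, T j := sum_nonneg fun j _ => hT j
  have hS : ∀ j, 0 ≤ S j := fun j => (hT j).trans (hTS j)
  rcases (hT0.trans hts).eq_or_lt with hs0 | hs
  · have hS0 : ∀ j, S j = 0 := fun j => by
      have := hSs j
      rw [← hs0] at this
      nlinarith [hS j]
    have hT00 : ∀ j, T j = 0 := fun j => le_antisymm ((hTS j).trans (hS0 j).le) (hT j)
    simp [hS0, hT00, ← hs0]
  set p : F × W := (x, ⟨fun j => X j - x, hxX⟩) with hp
  have hxs : ∀ j, xs p j = X j := fun j => by simp [xs, hp]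
  set u : Fin m → ℝ := fun j => T j / s with hu
  have hu0 : ∀ j, 0 ≤ u j := fun j => div_nonneg (hT j) hs.le
  have hTu : ∀ j, T j = s * u j := fun j => by rw [hu]; field_simp
  have hsumu : ∑ j, T j = s * ∑ j, u j := by
    rw [mul_sum]; exact sum_congr rfl fun j _ => hTu j
  have hu1 : ∑ j, u j ≤ 1 := by
    rw [hsumu] at hts
    nlinarith
  have hmain := mul_le_mul_of_nonneg_left (hR p u hu0 hu1) hs.le
  have hux0 : 0 ≤ ∑ j, u j := sum_nonneg fun j _ => hu0 j
  have hp1 : p.1 = x := rfl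
  have hp2 : (p.2 : Fin m → F) = fun i => X i - x := rfl
  simp only [hxs, hp1, hp2] at hmain
  set U := ∑ j, u j with hU
  -- pieces
  have b1 : M⁻¹ * ∑ j, |M * y + φ (fun i => X i - x) j| * T j
      ≤ |y| * (s * U) + s * (M⁻¹ * ∑ j, |φ (fun i => X i - x) j| * u j) := by
    have e : |y| * (s * U) + s * (M⁻¹ * ∑ j, |φ (fun i => X i - x) j| * u j)
        = M⁻¹ * ∑ j, (M * |y| + |φ (fun i => X i - x) j|) * T j := by
      rw [← hsumu]
      simp only [add_mul, sum_add_distrib, mul_add, ← mul_sum]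
      congr 1
      · field_simp
      · simp only [hTu, mul_sum]
        refine sum_congr rfl fun j _ => by ring
    rw [e]
    refine mul_le_mul_of_nonneg_left (sum_le_sum fun j _ => ?_) hMi.le
    refine mul_le_mul_of_nonneg_right ?_ (hT j)
    refine (abs_add_le _ _).trans ?_
    rw [abs_mul, abs_of_pos hM0]
  have b2 : M⁻¹ * ∑ j, C₁ * ‖X j‖ * T j = s * (C₁ * (M⁻¹ * ∑ j, ‖X j‖ * u j)) := by
    simp only [hTu, mul_sum]
    refine sum_congr rfl fun j _ => by ring
  have b3 : M⁻¹ * ∑ j, C₂ * ‖X j‖ * Real.sqrt (S j * T j)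
      ≤ s * (C₂ * (Real.sqrt U * AA M p)) := by
    have c1 : ∀ j, Real.sqrt (S j * T j) ≤ s * Real.sqrt N⁻¹ * Real.sqrt (u j) := by
      intro j
      rw [← Real.sqrt_sq hs.le, ← Real.sqrt_mul (by positivity), ← Real.sqrt_mul (by positivity)]
      apply Real.sqrt_le_sqrt
      have d1 : S j ≤ s * N⁻¹ := by
        rw [← div_eq_mul_inv, le_div_iff₀ hN]; linarith [hSs j]
      calc S j * T j ≤ (s * N⁻¹) * (s * u j) := by
            rw [← hTu]; exact mul_le_mul_of_nonneg_right d1 (hT j)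
        _ = _ := by ring
    have c2 : ∑ j, ‖X j‖ * Real.sqrt (u j) ≤ Real.sqrt (∑ j, ‖X j‖ ^ 2) * Real.sqrt U := by
      have := Real.sum_mul_le_sqrt_mul_sqrt univ (fun j => ‖X j‖) (fun j => Real.sqrt (u j))
      refine this.trans (le_of_eq ?_)
      rw [hU]
      congr 2
      exact sum_congr rfl fun j _ => Real.sq_sqrt (hu0 j)
    have c3 : AA M p = M⁻¹ * Real.sqrt N⁻¹ * Real.sqrt (∑ j, ‖X j‖ ^ 2) := by
      unfold AA
      simp only [hxs]
      have : M⁻¹ = Real.sqrt (M⁻¹ ^ 2) := (Real.sqrt_sq hMi.le).symm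
      rw [this, ← Real.sqrt_mul (by positivity), ← Real.sqrt_mul (by positivity), ← hMN]
      congr 1
      field_simp
    calc M⁻¹ * ∑ j, C₂ * ‖X j‖ * Real.sqrt (S j * T j)
        ≤ M⁻¹ * ∑ j, C₂ * ‖X j‖ * (s * Real.sqrt N⁻¹ * Real.sqrt (u j)) := by
          refine mul_le_mul_of_nonneg_left (sum_le_sum fun j _ => ?_) hMi.le
          exact mul_le_mul_of_nonneg_left (c1 j) (by positivity)
      _ = (M⁻¹ * C₂ * s * Real.sqrt N⁻¹) * ∑ j, ‖X j‖ * Real.sqrt (u j) := by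
          simp only [mul_sum]
          refine sum_congr rfl fun j _ => by ring
      _ ≤ (M⁻¹ * C₂ * s * Real.sqrt N⁻¹) * (Real.sqrt (∑ j, ‖X j‖ ^ 2) * Real.sqrt U) :=
          mul_le_mul_of_nonneg_left c2 (by positivity)
      _ = _ := by rw [c3]; ring
  have b4 : M⁻¹ * ∑ j, C₃ * (Z j - ‖X j‖) * S j
      ≤ C₃ * ((m : ℝ)⁻¹ * ∑ j, Z j - (m : ℝ)⁻¹ * ∑ j, ‖X j‖) * s := by
    have e : C₃ * ((m : ℝ)⁻¹ * ∑ j, Z j - (m : ℝ)⁻¹ * ∑ j, ‖X j‖) * s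
        = M⁻¹ * ∑ j, C₃ * (Z j - ‖X j‖) * (s * N⁻¹) := by
      rw [← mul_sub, ← sum_sub_distrib, ← sum_mul, ← mul_sum, ← hMN, mul_inv]
      ring
    rw [e]
    refine mul_le_mul_of_nonneg_left (sum_le_sum fun j _ => ?_) hMi.le
    refine mul_le_mul_of_nonneg_left ?_ (mul_nonneg hC₃ (sub_nonneg.mpr (hZ j)))
    rw [← div_eq_mul_inv, le_div_iff₀ hN]; linarith [hSs j]
  have b5 : Real.sqrt (s * ∑ j, T j) = s * Real.sqrt U := by
    rw [hsumu, ← mul_assoc, Real.sqrt_mul (by positivity), Real.sqrt_mul_self hs.le]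
  have b6 : DD p = (m : ℝ)⁻¹ * ∑ j, ‖X j‖ - ‖x‖ := by
    unfold DD
    simp only [hxs, hp1]
  rw [sum_add_distrib, sum_add_distrib, sum_add_distrib, mul_add, mul_add, mul_add, b2, b5, hsumu]
  rw [b6] at hmain
  linarith

end Helpers

/-- Theorem `Bellster`: for a geometric non-local space `W` and a canceling
operator `φ`, with `α = -κ'(1)/log m`, there are constants `1 ≤ C₁ ≤ C₂ ≤ C₃` such that
`Φ(x,y,z,t,s) = |y| t + C₁ |x| t + C₂ |x| √(s t) + C₃ (z - |x|) s` is a supersolution. -/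
theorem statement3 (m ℓ : ℕ) (hm : 2 ≤ m) (hℓ : 1 ≤ ℓ)
    (W : Submodule ℝ (Fin m → EuclideanSpace ℝ (Fin ℓ)))
    (hWV : ∀ w ∈ W, ∑ j, w j = 0)
    (φ : (Fin m → EuclideanSpace ℝ (Fin ℓ)) →ₗ[ℝ] (Fin m → ℝ))
    (hφV : ∀ w ∈ W, ∑ j, φ w j = 0)
    (α : ℝ) (hα : α ∈ Set.Ioo (0 : ℝ) 1)
    (hgeom : GeometricOfOrder (W : Set (Fin m → EuclideanSpace ℝ (Fin ℓ))) α)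
    (hnl : NonLocal (W : Set (Fin m → EuclideanSpace ℝ (Fin ℓ))) α)
    (hcanc : Canceling (W : Set (Fin m → EuclideanSpace ℝ (Fin ℓ))) α (fun w => φ w)) :
    ∃ C₁ C₂ C₃ : ℝ, 1 ≤ C₁ ∧ C₁ ≤ C₂ ∧ C₂ ≤ C₃ ∧
      Supersolution (W : Set (Fin m → EuclideanSpace ℝ (Fin ℓ))) (fun w => φ w) α
        (fun x y z t s =>
          |y| * t + C₁ * ‖x‖ * t + C₂ * ‖x‖ * Real.sqrt (s * t) + C₃ * (z - ‖x‖) * s) := by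
  have hm0 : (0 : ℝ) < m := by positivity
  have hm1 : (1 : ℝ) < m := by exact_mod_cast (show 1 < m by omega)
  have hα0 := hα.1
  have hα1 := hα.2
  have : NeZero m := ⟨by omega⟩
  set M : ℝ := (m : ℝ) ^ α with hMdef
  set N : ℝ := (m : ℝ) ^ ((1 : ℝ) - α) with hNdef
  have hM : 1 < M := Real.one_lt_rpow hm1 hα0
  have hN : 0 < N := Real.rpow_pos_of_pos hm0 _
  have hMN : M * N = m := by
    rw [hMdef, hNdef, ← Real.rpow_add hm0]; simp
  have hM0 : 0 < M := by linarith
  have hMb : ∀ v ∈ MW (W : Set (Fin m → EuclideanSpace ℝ (Fin ℓ))), ∀ j, 1 + v j ≤ M := by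
    have hg := hgeom 0 ⟨le_rfl, zero_le_one⟩
    rw [Fintype.card_fin, sub_zero, mul_one] at hg
    have hpos : 0 < α * Real.log m := mul_pos hα0 (Real.log_pos hm1)
    unfold kappa at hg
    intro v hv j
    have hbdd : BddAbove {r | ∃ v ∈ MW (W : Set (Fin m → EuclideanSpace ℝ (Fin ℓ))),
        r = kappaV (Fin m) v 0} := by
      by_contra hcon
      rw [Real.sSup_of_not_bddAbove hcon] at hg
      linarith
    have h1 := le_csSup hbdd ⟨v, hv, rfl⟩
    rw [hg] at h1
    simp only [kappaV, if_true] at h1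
    have h2 : 1 + v j ≤ ⨆ i, |1 + v i| :=
      (le_abs_self _).trans (le_ciSup (f := fun i => |1 + v i|) (Set.finite_range _).bddAbove j)
    by_cases h3 : 1 + v j ≤ 0
    · linarith
    push Not at h3
    have h4 : 0 < ⨆ i, |1 + v i| := h3.trans_le h2
    have h5 := (Real.log_le_iff_le_exp h4).mp h1
    refine h2.trans (h5.trans (le_of_eq ?_))
    rw [hMdef, Real.rpow_def_of_pos hm0, mul_comm]
  have hloc : ∀ (w : Fin m → EuclideanSpace ℝ (Fin ℓ)) (H : Finset (Fin m))
      (a : EuclideanSpace ℝ (Fin ℓ)), w ∈ W → a ≠ 0 →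
      (H.card : ℝ) * M = m → (∀ j ∈ H, w j = (M - 1) • a) → (∀ j ∉ H, w j = -a) →
      (∀ u ∈ W, ∀ b, (∀ j ∉ H, b + u j = 0) → ∃ c : ℝ, u = c • w) ∧ ∀ j ∈ H, φ w j = 0 := by
    intro w H a hw ha hc h1 h2
    have hext : IsExtremal (W : Set (Fin m → EuclideanSpace ℝ (Fin ℓ))) α w H := by
      refine ⟨hw, a, ha, ?_, ?_, h2⟩
      · rw [Fintype.card_fin, ← hNdef]
        refine mul_right_cancel₀ hM0.ne' ?_
        rw [hc, ← hMN, mul_comm]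
      · rw [Fintype.card_fin]; exact h1
    exact ⟨hnl w H hext, hcanc w H hext⟩
  obtain ⟨C₁, C₂, C₃, h1, h2, h3, hR⟩ := exists_constants (M := M) φ
    (fun p₀ hp₀ => local_case hM hm hWV φ hMb hloc p₀ hp₀)
  have hR' : ∀ p : EuclideanSpace ℝ (Fin ℓ) × W, RR M φ C₁ C₂ C₃ p := by
    intro p
    by_cases hp : p = 0
    · rw [hp]; exact RR_zero
    · exact hR p hp
  refine ⟨C₁, C₂, C₃, h1, h2, h3, ?_, ?_⟩
  · intro X y Z T S hZ hT hTS hX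
    simp only [Fintype.card_fin]
    rw [Real.rpow_neg hm0.le, ← hMdef, ← hNdef]
    refine main_of_RR (W := W) hM hN hMN hm φ (by linarith) (by linarith) (by linarith) hR' X
      (avg X) hX y Z T S _ hZ hT hTS (le_max_left _ _) (fun j => le_max_of_le_right ?_)
    exact mul_le_mul_of_nonneg_left (le_ciSup (Set.finite_range S).bddAbove j) hN.le
  · intro x y t s ht hts
    have : 0 ≤ C₁ * ‖x‖ * t := by positivity
    have : 0 ≤ C₂ * ‖x‖ * Real.sqrt (s * t) :=
      mul_nonneg (mul_nonneg (by linarith) (norm_nonneg _)) (Real.sqrt_nonneg _)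
    simp only [sub_self, mul_zero, zero_mul, add_zero]
    linarith

end TracePaper
end
end

section
/- For every a ∈ ℂ^d∖{0}, either there exists a nonempty set D ⊆ {1,…,d} such that (Ω_∇^{−1}(a) ∩ (−Ω_∇^{−1}(a))) ∪ {0} = ℓ_D, or Ω_∇^{−1}(a) ∩ (−Ω_∇^{−1}(a)) = ∅; here Ω_∇^{−1}(a) = {γ ∈ G∖{0} : a ∈ Ω_∇(γ)}. -/
open Finset

noncomputable section

namespace TracePaper

/-- The group `G = (ℤ/μ)^d`. -/
abbrev Gp (μ d : ℕ) : Type := Fin d → ZMod μ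

/-- The character value `e^{2πi z/μ}` for `z ∈ ℤ/μ` (via the representative `z.val`). -/
def ch (μ : ℕ) (z : ZMod μ) : ℂ :=
  Complex.exp (2 * Real.pi * Complex.I * (z.val : ℂ) / (μ : ℂ))

/-- The Fourier-side line `Ω_∇(γ) = ℂ (e^{2πiγ_1/μ}-1, …, e^{2πiγ_d/μ}-1)` of the space
`W_∇`, written as a vector. -/
def chv (μ d : ℕ) (γ : Gp μ d) : Fin d → ℂ := fun j => ch μ (γ j) - 1

/-- `Ω_∇⁻¹(a) = {γ ∈ G \ {0} : a ∈ Ω_∇(γ)}`. -/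
def OmGradInv (μ d : ℕ) (a : Fin d → ℂ) : Set (Gp μ d) :=
  {γ | γ ≠ 0 ∧ ∃ c : ℂ, a = c • chv μ d γ}

/-- The combinatorial line `ℓ_D` generated by `D ⊆ {1, …, d}`. -/
def lineD (μ d : ℕ) (D : Finset (Fin d)) : Set (Gp μ d) :=
  {x | ∃ b : ZMod μ, ∀ j, x j = if j ∈ D then b else 0}

theorem ch_eq (μ : ℕ) [NeZero μ] (z : ZMod μ) : ch μ z = ZMod.stdAddChar z := by
  rw [ZMod.stdAddChar_apply, ZMod.toCircle_apply, ch]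

theorem ch_one (μ : ℕ) [NeZero μ] (z : ZMod μ) : ch μ z = 1 ↔ z = 0 := by
  rw [ch_eq]
  constructor
  · intro h
    apply ZMod.injective_stdAddChar
    rw [h, AddChar.map_zero_eq_one]
  · rintro rfl
    exact AddChar.map_zero_eq_one _

theorem ch_inj (μ : ℕ) [NeZero μ] (z w : ZMod μ) (h : ch μ z = ch μ w) : z = w := by
  rw [ch_eq, ch_eq] at h
  exact ZMod.injective_stdAddChar h

theorem ch_neg_mul (μ : ℕ) [NeZero μ] (z : ZMod μ) : ch μ (-z) * ch μ z = 1 := by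
  rw [ch_eq, ch_eq, ← AddChar.map_add_eq_mul, neg_add_cancel, AddChar.map_zero_eq_one]

/-- Lemma `WgLemma`: for every `a ∈ ℂ^d \ {0}`, either
`(Ω_∇⁻¹(a) ∩ (-Ω_∇⁻¹(a))) ∪ {0}` is a combinatorial line `ℓ_D`, or
`Ω_∇⁻¹(a) ∩ (-Ω_∇⁻¹(a)) = ∅`. -/
theorem statement16 (μ d : ℕ) [NeZero μ] (hμ : 2 ≤ μ) (hd : 1 ≤ d)
    (a : Fin d → ℂ) (ha : a ≠ 0) :
    (∃ D : Finset (Fin d), D.Nonempty ∧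
        (OmGradInv μ d a ∩ {γ | -γ ∈ OmGradInv μ d a}) ∪ {0} = lineD μ d D) ∨
      OmGradInv μ d a ∩ {γ | -γ ∈ OmGradInv μ d a} = ∅ := by
  rcases Set.eq_empty_or_nonempty (OmGradInv μ d a ∩ {γ | -γ ∈ OmGradInv μ d a}) with h | h
  · exact Or.inr h
  left
  obtain ⟨γ, ⟨hγ, c, hc⟩, ⟨-, c', hc'⟩⟩ := h
  have hac : ∀ j, a j = c * (ch μ (γ j) - 1) := fun j => congrFun hc j
  have hac' : ∀ j, a j = c' * (ch μ (-(γ j)) - 1) := fun j => congrFun hc' j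
  have hc0 : c ≠ 0 := by
    rintro rfl
    exact ha (by simpa using hc)
  have key : ∀ x ∈ OmGradInv μ d a ∩ {γ | -γ ∈ OmGradInv μ d a},
      (∀ j, a j = 0 → x j = 0) ∧ ∀ i j, a i ≠ 0 → a j ≠ 0 → x i = x j := by
    rintro x ⟨⟨-, e, he⟩, ⟨-, e', he'⟩⟩
    have h1 : ∀ j, a j = e * (ch μ (x j) - 1) := fun j => congrFun he j
    have h2 : ∀ j, a j = e' * (ch μ (-(x j)) - 1) := fun j => congrFun he' j
    have e0 : e ≠ 0 := by
      rintro rfl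
      exact ha (by simpa using he)
    have h3 : ∀ j, a j ≠ 0 → e * ch μ (x j) = -e' := by
      intro j hj
      have hn : ch μ (x j) - 1 ≠ 0 := by
        intro h
        exact hj (by rw [h1, h, mul_zero])
      apply mul_right_cancel₀ hn
      linear_combination ch μ (x j) * (h2 j) - ch μ (x j) * (h1 j) + e' * ch_neg_mul μ (x j)
    refine ⟨fun j hj => ?_, fun i j hi hj => ?_⟩
    · rw [h1] at hj
      exact (ch_one μ _).1 (sub_eq_zero.1 ((mul_eq_zero.1 hj).resolve_left e0))
    · exact ch_inj μ _ _ (mul_left_cancel₀ e0 ((h3 i hi).trans (h3 j hj).symm))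
  obtain ⟨i, hi⟩ : ∃ i, a i ≠ 0 := Function.ne_iff.1 ha
  have kγ := key γ ⟨⟨hγ, c, hc⟩, ⟨by simpa using hγ, c', hc'⟩⟩
  have conv : ∀ b : ZMod μ, b ≠ 0 → ∀ x : Gp μ d, (∀ j, x j = if a j ≠ 0 then b else 0) →
      x ∈ OmGradInv μ d a := by
    intro b hb x hx
    have hb1 : ch μ b - 1 ≠ 0 := fun h => hb ((ch_one μ b).1 (sub_eq_zero.1 h))
    refine ⟨fun h => hb ?_, a i / (ch μ b - 1), ?_⟩
    · have := hx i
      rw [if_pos hi, h] at this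
      exact this.symm
    · funext j
      change a j = a i / (ch μ b - 1) * (ch μ (x j) - 1)
      rw [hx j]
      by_cases hj : a j = 0
      · rw [if_neg (not_not.2 hj), (ch_one μ 0).2 rfl, hj]
        ring
      · rw [if_pos hj, div_mul_cancel₀ _ hb1, hac j, hac i, kγ.2 i j hi hj]
  classical
  refine ⟨Finset.univ.filter (fun j => a j ≠ 0), ⟨i, by simpa using hi⟩, ?_⟩
  ext x
  constructor
  · rintro (hx | hx)
    · have k := key x hx
      refine ⟨x i, fun j => ?_⟩
      by_cases hj : a j = 0
      · simp [hj, k.1 j hj]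
      · simp [hj, k.2 j i hj hi]
    · rw [Set.mem_singleton_iff] at hx
      subst hx
      exact ⟨0, fun j => by simp⟩
  · rintro ⟨b, hb⟩
    by_cases hb0 : b = 0
    · right
      rw [Set.mem_singleton_iff]
      funext j
      rw [hb j, hb0]
      simp
    · left
      have hb' : ∀ j, x j = if a j ≠ 0 then b else 0 := fun j => by
        rw [hb j]
        simp
      refine ⟨conv b hb0 x hb', conv (-b) (by simpa using hb0) (-x) fun j => ?_⟩
      rw [Pi.neg_apply, hb' j]
      split_ifs <;> simp

end TracePaper
end
end
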